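/- Let (X,d) be a locally compact, non-compact metric space that is a J-space, let G be its group of surjective isometries, and let P be the unique non-compact pseudo-component of X. If x, y ∈ P and {g_n} is a sequence in G with g_n·x → y, then there exist a subsequence {g_{n_k}} and a surjective isometry f : X → X with f(x) = y such that g_{n_k}·z → f(z) for every z ∈ X. -/

import Mathlib

open Metric Set Filter Topology
open scoped ENNReal

/-- The radius of compactness of a point `x` in a metric space: the supremum of all
radii `r > 0` such that the closed closure of the open ball `B(x,r)` is compact. -/
noncomputable def radiusOfCompactness {X : Type*} [MetricSpace X] (x : X) : ℝ≥0∞ :=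
  ⨆ (r : ℝ) (_ : 0 < r ∧ IsCompact (closure (Metric.ball x r))), ENNReal.ofReal r

/-- The relation `x R y ↔ d(x,y) < ρ(x)`. -/
def pcRel {X : Type*} [MetricSpace X] (x y : X) : Prop :=
  ENNReal.ofReal (dist x y) < radiusOfCompactness x

/-- The equivalence relation `E`: `x E y` iff `x = y` or (`x R* y` and `y R* x`), where
`R*` is the transitive closure of `R`. -/
def pcEquiv {X : Type*} [MetricSpace X] (x y : X) : Prop :=
  x = y ∨ (Relation.TransGen pcRel x y ∧ Relation.TransGen pcRel y x)

/-- The pseudo-component of `x`: its `E`-equivalence class. -/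
def pseudoComponent {X : Type*} [MetricSpace X] (x : X) : Set X :=
  {y | pcEquiv x y}

/-- A topological space `X` is a J-space if whenever `A, B` are closed sets with
`A ∪ B = X` and `A ∩ B` compact, then `A` or `B` is compact. -/
def IsJSpace (X : Type*) [TopologicalSpace X] : Prop :=
  ∀ A B : Set X, IsClosed A → IsClosed B → A ∪ B = Set.univ →
    IsCompact (A ∩ B) → IsCompact A ∨ IsCompact B

/-- The topology of pointwise convergence on the group of surjective isometries of `X`. -/
noncomputable instance isomGroupTopology (X : Type*) [MetricSpace X] :
    TopologicalSpace (X ≃ᵢ X) :=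
  TopologicalSpace.induced (fun g => (g : X → X)) Pi.topologicalSpace

section PseudoComponents

variable {X : Type*} [MetricSpace X]

lemma pcRel_iff_exists_isCompact {a b : X} :
    pcRel a b ↔ ∃ r : ℝ, dist a b < r ∧ IsCompact (closure (ball a r)) := by
  unfold pcRel radiusOfCompactness
  simp only [lt_iSup_iff]
  constructor
  · rintro ⟨r, ⟨hr, hc⟩, h⟩
    exact ⟨r, (ENNReal.ofReal_lt_ofReal_iff hr).1 h, hc⟩
  · rintro ⟨r, h, hc⟩
    have hr : 0 < r := dist_nonneg.trans_lt h
    exact ⟨r, ⟨hr, hc⟩, (ENNReal.ofReal_lt_ofReal_iff hr).2 h⟩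

lemma pcRel_refl [LocallyCompactSpace X] (a : X) : pcRel a a := by
  obtain ⟨K, hK, ha⟩ := exists_compact_mem_nhds a
  obtain ⟨r, hr, h⟩ := Metric.mem_nhds_iff.1 ha
  exact pcRel_iff_exists_isCompact.2 ⟨r, by simpa using hr, hK.closure_of_subset h⟩

lemma isOpen_setOf_pcRel : IsOpen {p : X × X | pcRel p.1 p.2} := by
  rw [Metric.isOpen_iff]
  rintro ⟨a, b⟩ h
  obtain ⟨r, hr, hc⟩ := pcRel_iff_exists_isCompact.1 h
  refine ⟨(r - dist a b) / 3, by linarith, ?_⟩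
  rintro ⟨a', b'⟩ h'
  rw [mem_ball, Prod.dist_eq, max_lt_iff] at h'
  obtain ⟨ha, hb⟩ := h'
  dsimp only at ha hb
  have hab : dist a' b' ≤ dist a' a + dist a b + dist b' b := by
    rw [dist_comm b' b]; exact dist_triangle4 _ _ _ _
  refine pcRel_iff_exists_isCompact.2 ⟨r - dist a' a, by dsimp only; linarith, ?_⟩
  exact hc.of_isClosed_subset isClosed_closure (closure_mono (ball_subset_ball' (by simp)))

lemma IsometryEquiv.isCompact_closure_ball (g : X ≃ᵢ X) {a : X} {r : ℝ}
    (h : IsCompact (closure (ball a r))) : IsCompact (closure (ball (g a) r)) := by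
  have hg := g.toHomeomorph.image_closure (ball a r)
  rw [g.coe_toHomeomorph, g.image_ball] at hg
  exact hg ▸ h.image g.continuous

lemma IsometryEquiv.pcRel_map (g : X ≃ᵢ X) {a b : X} (h : pcRel a b) : pcRel (g a) (g b) := by
  obtain ⟨r, hr, hc⟩ := pcRel_iff_exists_isCompact.1 h
  exact pcRel_iff_exists_isCompact.2 ⟨r, by rwa [g.dist_eq], g.isCompact_closure_ball hc⟩

lemma IsometryEquiv.pcEquiv_map (g : X ≃ᵢ X) {a b : X} (h : pcEquiv a b) :
    pcEquiv (g a) (g b) :=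
  h.imp (congrArg g) fun h =>
    ⟨h.1.lift g fun _ _ => g.pcRel_map, h.2.lift g fun _ _ => g.pcRel_map⟩

lemma pcEquiv.symm {a b : X} (h : pcEquiv a b) : pcEquiv b a :=
  h.imp Eq.symm And.symm

lemma pcEquiv.trans {a b c : X} (h : pcEquiv a b) (h' : pcEquiv b c) : pcEquiv a c := by
  rcases h with rfl | h
  · exact h'
  · rcases h' with rfl | h'
    · exact .inr h
    · exact .inr ⟨h.1.trans h'.1, h'.2.trans h.2⟩

lemma pcEquiv.transGen [LocallyCompactSpace X] {a b : X} (h : pcEquiv a b) :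
    Relation.TransGen pcRel a b := by
  rcases h with rfl | h
  · exact .single (pcRel_refl a)
  · exact h.1

lemma eventually_pcEquiv [LocallyCompactSpace X] (a : X) : ∀ᶠ b in 𝓝 a, pcEquiv a b := by
  have h₁ : ∀ᶠ b in 𝓝 a, pcRel a b :=
    (isOpen_setOf_pcRel.preimage (Continuous.prodMk_right a)).mem_nhds (pcRel_refl a)
  have h₂ : ∀ᶠ b in 𝓝 a, pcRel b a :=
    (isOpen_setOf_pcRel.preimage (Continuous.prodMk_left a)).mem_nhds (pcRel_refl a)
  filter_upwards [h₁, h₂] with b hb hb'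
  exact .inr ⟨.single hb, .single hb'⟩

lemma isClopen_pseudoComponent [LocallyCompactSpace X] (a : X) :
    IsClopen (pseudoComponent a) := by
  refine ⟨⟨isOpen_iff_mem_nhds.2 fun b hb => ?_⟩, isOpen_iff_mem_nhds.2 fun b hb => ?_⟩
  · filter_upwards [eventually_pcEquiv b] with c hc h
    exact hb (pcEquiv.trans h hc.symm)
  · filter_upwards [eventually_pcEquiv b] with c hc
    exact pcEquiv.trans hb hc

lemma isSeparable_setOf_pcRel (a : X) : TopologicalSpace.IsSeparable {b | pcRel a b} := by
  have h : {b | pcRel a b} ⊆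
      ⋃ q : {q : ℚ // IsCompact (closure (ball a (q : ℝ)))}, closure (ball a ((q : ℚ) : ℝ)) := by
    intro b hb
    obtain ⟨r, hr, hc⟩ := pcRel_iff_exists_isCompact.1 hb
    obtain ⟨q, hq, hq'⟩ := exists_rat_btwn hr
    refine mem_iUnion.2 ⟨⟨q, hc.of_isClosed_subset isClosed_closure
      (closure_mono (ball_subset_ball hq'.le))⟩, subset_closure ?_⟩
    rwa [mem_ball']
  exact (TopologicalSpace.IsSeparable.iUnion fun q => q.2.isSeparable).mono h

lemma TopologicalSpace.IsSeparable.setOf_exists_pcRel {U : Set X}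
    (hU : TopologicalSpace.IsSeparable U) :
    TopologicalSpace.IsSeparable {b | ∃ a ∈ U, pcRel a b} := by
  obtain ⟨c, hc, hUc⟩ := hU
  have := hc.to_subtype
  refine (TopologicalSpace.IsSeparable.iUnion fun a : c => isSeparable_setOf_pcRel (a : X)).mono ?_
  rintro b ⟨a, ha, hab⟩
  obtain ⟨a', h, ha'⟩ := mem_closure_iff.1 (hUc ha) _
    (isOpen_setOf_pcRel.preimage (Continuous.prodMk_left b)) hab
  exact mem_iUnion.2 ⟨⟨a', ha'⟩, h⟩

lemma isSeparable_setOf_transGen_pcRel (a : X) :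
    TopologicalSpace.IsSeparable {b | Relation.TransGen pcRel a b} := by
  let F : Set X → Set X := fun U => {b | ∃ a ∈ U, pcRel a b}
  have hF : ∀ n : ℕ, TopologicalSpace.IsSeparable (F^[n] {a}) := by
    intro n
    induction n with
    | zero => exact (countable_singleton a).isSeparable
    | succ n ih => rw [Function.iterate_succ_apply']; exact ih.setOf_exists_pcRel
  refine (TopologicalSpace.IsSeparable.iUnion hF).mono fun b hb => ?_
  induction hb with
  | single h => exact mem_iUnion.2 ⟨1, a, rfl, h⟩
  | tail _ h ih =>
    obtain ⟨n, hn⟩ := mem_iUnion.1 ih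
    refine mem_iUnion.2 ⟨n + 1, ?_⟩
    rw [Function.iterate_succ_apply']
    exact ⟨_, hn, h⟩

lemma pcRel.exists_isCompact_orbit {ι : Type*} {g : ι → X ≃ᵢ X} {a b : X} (hab : pcRel a b)
    (ha : ∃ K, IsCompact K ∧ ∀ i, g i a ∈ K) : ∃ K, IsCompact K ∧ ∀ i, g i b ∈ K := by
  obtain ⟨K, hK, hgK⟩ := ha
  obtain ⟨r, hr, hc⟩ := pcRel_iff_exists_isCompact.1 hab
  have htb : TotallyBounded (range fun i => g i a) :=
    hK.totallyBounded.subset (range_subset_iff.2 hgK)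
  obtain ⟨t, htr, htf, ht⟩ :=
    totallyBounded_iff_subset.1 htb _ (Metric.dist_mem_uniformity (sub_pos.2 hr))
  refine ⟨⋃ p ∈ t, closure (ball p r), htf.isCompact_biUnion fun p hp => ?_, fun i => ?_⟩
  · obtain ⟨i, rfl⟩ := htr hp
    exact (g i).isCompact_closure_ball hc
  · obtain ⟨p, hp, hip⟩ := mem_iUnion₂.1 (ht (mem_range_self i))
    refine mem_iUnion₂.2 ⟨p, hp, subset_closure ?_⟩
    have hip' : dist (g i a) p < r - dist a b := hip
    have := dist_triangle_left (g i b) p (g i a)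
    rw [(g i).dist_eq] at this
    rw [mem_ball]
    linarith

lemma transGen_pcRel_exists_isCompact_orbit {ι : Type*} {g : ι → X ≃ᵢ X} {a b : X}
    (hab : Relation.TransGen pcRel a b) (ha : ∃ K, IsCompact K ∧ ∀ i, g i a ∈ K) :
    ∃ K, IsCompact K ∧ ∀ i, g i b ∈ K := by
  induction hab with
  | single h => exact h.exists_isCompact_orbit ha
  | tail _ h ih => exact h.exists_isCompact_orbit ih

lemma isCompact_compl_pseudoComponent [LocallyCompactSpace X] (hJ : IsJSpace X) {p : X}
    (hp : ¬ IsCompact (pseudoComponent p)) : IsCompact (pseudoComponent p)ᶜ := by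
  have h := isClopen_pseudoComponent p
  exact (hJ _ _ h.isClosed h.compl.isClosed (union_compl_self _) (by simp)).resolve_left hp

lemma IsometryEquiv.apply_notMem_pseudoComponent [LocallyCompactSpace X] (hJ : IsJSpace X)
    {p : X} (hp : ¬ IsCompact (pseudoComponent p)) (g : X ≃ᵢ X) {z : X}
    (hz : z ∉ pseudoComponent p) : g z ∉ pseudoComponent p := by
  intro hgz
  have hQ : IsCompact (pseudoComponent z) :=
    (isCompact_compl_pseudoComponent hJ hp).of_isClosed_subset
      (isClopen_pseudoComponent z).isClosed
      fun w hw hw' => hz (pcEquiv.trans hw' (pcEquiv.symm hw))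
  refine hp ((hQ.image g.continuous).of_isClosed_subset
    (isClopen_pseudoComponent p).isClosed fun w hw => ⟨g.symm w, ?_, g.apply_symm_apply w⟩)
  have := g.symm.pcEquiv_map (pcEquiv.trans (pcEquiv.symm hgz) hw)
  rwa [g.symm_apply_apply] at this

lemma exists_isCompact_orbit_of_tendsto [LocallyCompactSpace X] (hJ : IsJSpace X) {p : X}
    (hp : ¬ IsCompact (pseudoComponent p)) {x y : X} (hx : x ∈ pseudoComponent p)
    {g : ℕ → X ≃ᵢ X} (hg : Tendsto (fun n => g n x) atTop (𝓝 y)) (z : X) :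
    ∃ K, IsCompact K ∧ ∀ n, g n z ∈ K := by
  by_cases hz : z ∈ pseudoComponent p
  · exact transGen_pcRel_exists_isCompact_orbit (pcEquiv.trans (pcEquiv.symm hx) hz).transGen
      ⟨_, hg.isCompact_insert_range, fun n => .inr (mem_range_self n)⟩
  · exact ⟨_, isCompact_compl_pseudoComponent hJ hp,
      fun n => (g n).apply_notMem_pseudoComponent hJ hp hz⟩

lemma separableSpace_of_isJSpace [LocallyCompactSpace X] (hJ : IsJSpace X) {p : X}
    (hp : ¬ IsCompact (pseudoComponent p)) : TopologicalSpace.SeparableSpace X := by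
  rw [← TopologicalSpace.isSeparable_univ_iff, ← union_compl_self (pseudoComponent p)]
  exact ((isSeparable_setOf_transGen_pcRel p).mono fun _ => pcEquiv.transGen).union
    (isCompact_compl_pseudoComponent hJ hp).isSeparable

end PseudoComponents

lemma exists_subseq_tendsto_of_isometry {X : Type*} [MetricSpace X]
    [TopologicalSpace.SeparableSpace X] {g : ℕ → X → X} (hg : ∀ n, Isometry (g n))
    (hK : ∀ z, ∃ K, IsCompact K ∧ ∀ n, g n z ∈ K) :
    ∃ φ : ℕ → ℕ, StrictMono φ ∧ ∃ f : X → X, ∀ z, Tendsto (fun k => g (φ k) z) atTop (𝓝 (f z)) := by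
  choose K hKc hgK using hK
  obtain ⟨D, hD, hDd⟩ := TopologicalSpace.exists_countable_dense X
  have := hD.to_subtype
  obtain ⟨a, -, φ, hφ, ha⟩ := (isCompact_univ_pi fun d : D => hKc d).tendsto_subseq
    (x := fun n (d : D) => g n d) fun n d _ => hgK d n
  refine ⟨φ, hφ, ?_⟩
  suffices h : ∀ z, ∃ w, Tendsto (fun k => g (φ k) z) atTop (𝓝 w) by
    choose f hf using h
    exact ⟨f, hf⟩
  intro z
  have hC : CauchySeq fun k => g (φ k) z := by
    rw [Metric.cauchySeq_iff]
    intro ε hε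
    obtain ⟨d, hd, hzd⟩ := hDd.exists_dist_lt z (show 0 < ε / 3 by positivity)
    obtain ⟨N, hN⟩ := Metric.cauchySeq_iff.1 (tendsto_pi_nhds.1 ha ⟨d, hd⟩).cauchySeq (ε / 3)
      (by positivity)
    refine ⟨N, fun m hm n hn => ?_⟩
    have h₁ : dist (g (φ m) d) (g (φ n) d) < ε / 3 := hN m hm n hn
    have h₂ := dist_triangle4 (g (φ m) z) (g (φ m) d) (g (φ n) d) (g (φ n) z)
    rw [(hg _).dist_eq, (hg _).dist_eq, dist_comm d z] at h₂
    linarith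
  obtain ⟨w, -, hw⟩ :=
    cauchySeq_tendsto_of_isComplete (hKc z).isComplete (fun k => hgK z (φ k)) hC
  exact ⟨w, hw⟩

lemma Isometry.of_tendsto {X : Type*} [MetricSpace X] {g : ℕ → X → X} (hg : ∀ n, Isometry (g n))
    {f : X → X} (hf : ∀ z, Tendsto (fun n => g n z) atTop (𝓝 (f z))) : Isometry f :=
  Isometry.of_dist_eq fun a b => tendsto_nhds_unique ((hf a).dist (hf b))
    (by simp only [(hg _).dist_eq, tendsto_const_nhds])

/-- If isometries `g n` converge pointwise to `f` and their inverses to `h`, then `h` is a right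
inverse of `f`. -/
lemma IsometryEquiv.rightInverse_of_tendsto {X : Type*} [MetricSpace X] {g : ℕ → X ≃ᵢ X}
    {f h : X → X} (hf : ∀ z, Tendsto (fun n => g n z) atTop (𝓝 (f z)))
    (hh : ∀ z, Tendsto (fun n => (g n).symm z) atTop (𝓝 (h z))) : Function.RightInverse h f := by
  intro z
  refine tendsto_nhds_unique (hf (h z)) (tendsto_iff_dist_tendsto_zero.2 ?_)
  refine (tendsto_iff_dist_tendsto_zero.1 (hh z)).congr fun n => ?_
  rw [← (g n).dist_eq, (g n).apply_symm_apply, dist_comm]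

/-- If `x, y` lie in the unique non-compact pseudo-component `P` of a
locally compact, non-compact metric J-space and `g_n·x → y` for a sequence of isometries,
then some subsequence converges pointwise on all of `X` to a surjective isometry `f` of
`X` with `f(x) = y`. -/
theorem exists_subseq_tendsto_isometryEquiv
    {X : Type*} [MetricSpace X] [LocallyCompactSpace X]
    (hnc : ¬ CompactSpace X) (hJ : IsJSpace X)
    (P : Set X) (hP : P ∈ Set.range (pseudoComponent (X := X)))
    (hPnc : ¬ IsCompact P)
    (x y : X) (hx : x ∈ P) (hy : y ∈ P) (g : ℕ → X ≃ᵢ X)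
    (hg : Filter.Tendsto (fun n => g n x) Filter.atTop (nhds y)) :
    ∃ φ : ℕ → ℕ, StrictMono φ ∧
      ∃ f : X ≃ᵢ X, f x = y ∧
        ∀ z : X, Filter.Tendsto (fun k => g (φ k) z) Filter.atTop (nhds (f z)) := by
  obtain ⟨p, rfl⟩ := hP
  have := separableSpace_of_isJSpace hJ hPnc
  obtain ⟨φ, hφ, f, hf⟩ := exists_subseq_tendsto_of_isometry (fun n => (g n).isometry)
    (exists_isCompact_orbit_of_tendsto hJ hPnc hx hg)
  have hg' : Tendsto (fun k => (g (φ k)).symm y) atTop (𝓝 x) := by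
    refine tendsto_iff_dist_tendsto_zero.2 ?_
    refine (tendsto_iff_dist_tendsto_zero.1 (hg.comp hφ.tendsto_atTop)).congr fun k => ?_
    rw [← (g (φ k)).dist_eq ((g (φ k)).symm y), (g (φ k)).apply_symm_apply, dist_comm,
      Function.comp_apply]
  obtain ⟨ψ, hψ, h, hh⟩ := exists_subseq_tendsto_of_isometry
    (fun k => (g (φ k)).symm.isometry) (exists_isCompact_orbit_of_tendsto hJ hPnc hy hg')
  have hfψ : ∀ z, Tendsto (fun k => g (φ (ψ k)) z) atTop (𝓝 (f z)) :=
    fun z => (hf z).comp hψ.tendsto_atTop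
  refine ⟨φ ∘ ψ, hφ.comp hψ, ⟨⟨f, h, ?_, ?_⟩, ?_⟩, ?_, hfψ⟩
  · exact IsometryEquiv.rightInverse_of_tendsto (g := fun k => (g (φ (ψ k))).symm) hh hfψ
  · exact IsometryEquiv.rightInverse_of_tendsto hfψ hh
  · exact Isometry.of_tendsto (fun k => (g (φ (ψ k))).isometry) hfψ
  · exact tendsto_nhds_unique (hf x) (hg.comp hφ.tendsto_atTop)
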